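/- Let Ω ⊆ ℝ × ℝ³ be open, let ω₁, ω₂, ω₃ : Ω → ℝ be C², let B = (B₁,B₂,B₃) : ℝ³ → ℝ³ be C¹, let F_{a0}, F_{ai} : ℝ → ℝ (a,i = 1,2,3) and T₀, T₁, T₂, T₃ : ℝ → ℝ be functions, and let λ = (λ₁,λ₂,λ₃) ∈ ℝ³. Assume that for all (t,x) ∈ Ω: (i) ∇_x ω_i · ∇_x ω_j = 0 for i ≠ j; (ii) Σ_{i=1}^3 F_{ia}(ω_i(t,x)) ‖∇_x ω_i(t,x)‖² = T_a(t) for a = 1,2,3; (iii) B(x)·∇_x ω_a + ∂_t ω_a + Δ_x ω_a = 0 for a = 1,2,3; (iv) Σ_{i=1}^3 F_{i0}(ω_i(t,x)) ‖∇_x ω_i(t,x)‖² + T₀(t) + div B(x) = 0. Let φ₀ : ℝ → ℝ be differentiable with φ₀'(t) = (T₀(t) − Σ_{i=1}^3 T_i(t)λ_i) φ₀(t), and let φ_a : ℝ → ℝ (a = 1,2,3) be twice differentiable with φ_a''(s) = (F_{a0}(s) + Σ_{i=1}^3 F_{ai}(s)λ_i) φ_a(s). Then the function u(t,x) := φ₀(t)·φ₁(ω₁(t,x))·φ₂(ω₂(t,x))·φ₃(ω₃(t,x))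 satisfies ∂_t u + Δ_x u + Σ_{a=1}^3 ∂_{x_a}(B_a(x) u) = 0 at every point of Ω. -/

import Mathlib

/-- Spatial partial derivative `∂f/∂x_a` of a function on `ℝ × ℝ³`. -/
noncomputable def pdx (a : Fin 3) (f : ℝ × (Fin 3 → ℝ) → ℝ)
    (p : ℝ × (Fin 3 → ℝ)) : ℝ :=
  deriv (fun s => f (p.1, Function.update p.2 a s)) (p.2 a)

/-- Time partial derivative `∂f/∂t` of a function on `ℝ × ℝ³`. -/
noncomputable def pdt (f : ℝ × (Fin 3 → ℝ) → ℝ) (p : ℝ × (Fin 3 → ℝ)) : ℝ :=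
  deriv (fun s => f (s, p.2)) p.1

/-- Partial derivative `∂g/∂x_a` of a function on `ℝ³`. -/
noncomputable def pds (a : Fin 3) (g : (Fin 3 → ℝ) → ℝ) (x : Fin 3 → ℝ) : ℝ :=
  deriv (fun s => g (Function.update x a s)) (x a)

open Filter Topology in
lemma line_tendsto (a : Fin 3) (p : ℝ × (Fin 3 → ℝ)) :
    HasDerivAt (fun s : ℝ => ((p.1, Function.update p.2 a s) : ℝ × (Fin 3 → ℝ)))
      (0, Pi.single a 1) (p.2 a) :=
  (hasDerivAt_const _ _).prodMk (hasDerivAt_update p.2 a (p.2 a))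

lemma line_self (a : Fin 3) (p : ℝ × (Fin 3 → ℝ)) :
    ((p.1, Function.update p.2 a (p.2 a)) : ℝ × (Fin 3 → ℝ)) = p := by
  simp

lemma hasDeriv_fderiv (a : Fin 3) (f : ℝ × (Fin 3 → ℝ) → ℝ) (p : ℝ × (Fin 3 → ℝ))
    (hf : DifferentiableAt ℝ f p) :
    HasDerivAt (fun s => f (p.1, Function.update p.2 a s))
      (fderiv ℝ f p (0, Pi.single a 1)) (p.2 a) := by
  have h : HasFDerivAt f (fderiv ℝ f p) (p.1, Function.update p.2 a (p.2 a)) := by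
    rw [line_self]; exact hf.hasFDerivAt
  exact h.comp_hasDerivAt (p.2 a) (line_tendsto a p)

lemma pdx_eq_fderiv (a : Fin 3) (f : ℝ × (Fin 3 → ℝ) → ℝ) (p : ℝ × (Fin 3 → ℝ))
    (hf : DifferentiableAt ℝ f p) : pdx a f p = fderiv ℝ f p (0, Pi.single a 1) :=
  (hasDeriv_fderiv a f p hf).deriv

lemma hasDeriv_pdx (a : Fin 3) (f : ℝ × (Fin 3 → ℝ) → ℝ) (p : ℝ × (Fin 3 → ℝ))
    (hf : DifferentiableAt ℝ f p) :
    HasDerivAt (fun s => f (p.1, Function.update p.2 a s)) (pdx a f p) (p.2 a) := by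
  rw [pdx_eq_fderiv a f p hf]; exact hasDeriv_fderiv a f p hf

lemma hasDeriv_pdt (f : ℝ × (Fin 3 → ℝ) → ℝ) (p : ℝ × (Fin 3 → ℝ))
    (hf : DifferentiableAt ℝ f p) :
    HasDerivAt (fun s => f (s, p.2)) (pdt f p) p.1 := by
  have h : HasDerivAt (fun s : ℝ => ((s, p.2) : ℝ × (Fin 3 → ℝ))) (1, 0) p.1 :=
    (hasDerivAt_id _).prodMk (hasDerivAt_const _ _)
  have h2 : HasFDerivAt f (fderiv ℝ f p) (p.1, p.2) := hf.hasFDerivAt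
  exact (h2.comp_hasDerivAt p.1 h).differentiableAt.hasDerivAt

open Filter Topology in
lemma pdx_congr (a : Fin 3) (f g : ℝ × (Fin 3 → ℝ) → ℝ) (p : ℝ × (Fin 3 → ℝ))
    (h : f =ᶠ[𝓝 p] g) : pdx a f p = pdx a g p := by
  have ht := (line_tendsto a p).continuousAt.tendsto
  rw [line_self] at ht
  exact Filter.EventuallyEq.deriv_eq (ht.eventually h)

open Filter Topology in
lemma diff_pdx (a : Fin 3) (f : ℝ × (Fin 3 → ℝ) → ℝ) (Ω : Set (ℝ × (Fin 3 → ℝ)))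
    (hΩ : IsOpen Ω) (hf : ContDiffOn ℝ 2 f Ω) (p : ℝ × (Fin 3 → ℝ)) (hp : p ∈ Ω) :
    DifferentiableAt ℝ (pdx a f) p := by
  have h1 : DifferentiableAt ℝ (fun q => fderiv ℝ f q (0, Pi.single a 1)) p := by
    have : ContDiffAt ℝ 1 (fderiv ℝ f) p :=
      (hf.contDiffAt (hΩ.mem_nhds hp)).fderiv_right (by norm_num)
    exact (this.differentiableAt (by norm_num)).clm_apply (differentiableAt_const _)
  refine h1.congr_of_eventuallyEq ?_
  filter_upwards [hΩ.mem_nhds hp] with q hq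
  exact pdx_eq_fderiv a f q ((hf.contDiffAt (hΩ.mem_nhds hq)).differentiableAt (by norm_num))

/-- if `ω₁, ω₂, ω₃` solve the separation system (2.4a)–(2.4d) and
`φ₀, φ₁, φ₂, φ₃` solve the separation equations (2.l), then the product Ansatz
`u = φ₀(t) φ₁(ω₁) φ₂(ω₂) φ₃(ω₃)` solves the Fokker–Planck equation
`∂ₜu + Δu + Σₐ ∂ₐ(Bₐ u) = 0` on `Ω`. -/
theorem stmt_1 (Ω : Set (ℝ × (Fin 3 → ℝ))) (hΩ : IsOpen Ω)
    (ω : Fin 3 → ℝ × (Fin 3 → ℝ) → ℝ) (hω : ∀ i, ContDiffOn ℝ 2 (ω i) Ω)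
    (B : (Fin 3 → ℝ) → (Fin 3 → ℝ)) (hB : ContDiff ℝ 1 B)
    (F0 : Fin 3 → ℝ → ℝ) (F : Fin 3 → Fin 3 → ℝ → ℝ)
    (T0 : ℝ → ℝ) (T : Fin 3 → ℝ → ℝ) (lam : Fin 3 → ℝ)
    -- (i) equation (2.4a): orthogonality of the gradients
    (h1 : ∀ p ∈ Ω, ∀ i j : Fin 3, i ≠ j →
      (∑ a : Fin 3, pdx a (ω i) p * pdx a (ω j) p) = 0)
    -- (ii) equation (2.4b): Stäckel conditions
    (h2 : ∀ p ∈ Ω, ∀ a : Fin 3,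
      (∑ i : Fin 3, F i a (ω i p) * ∑ j : Fin 3, (pdx j (ω i) p) ^ 2) = T a p.1)
    -- (iii) equation (2.4c)
    (h3 : ∀ p ∈ Ω, ∀ a : Fin 3,
      (∑ j : Fin 3, B p.2 j * pdx j (ω a) p) + pdt (ω a) p
        + (∑ j : Fin 3, pdx j (pdx j (ω a)) p) = 0)
    -- (iv) equation (2.4d)
    (h4 : ∀ p ∈ Ω,
      (∑ i : Fin 3, F0 i (ω i p) * ∑ j : Fin 3, (pdx j (ω i) p) ^ 2) + T0 p.1
        + (∑ a : Fin 3, pds a (fun y => B y a) p.2) = 0)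
    -- separation equations (2.l)
    (φ₀ : ℝ → ℝ) (hφ₀ : Differentiable ℝ φ₀)
    (hφ₀' : ∀ t : ℝ, deriv φ₀ t = (T0 t - ∑ i : Fin 3, T i t * lam i) * φ₀ t)
    (φ : Fin 3 → ℝ → ℝ) (hφ : ∀ a, Differentiable ℝ (φ a))
    (hφ' : ∀ a, Differentiable ℝ (deriv (φ a)))
    (hφ'' : ∀ (a : Fin 3) (s : ℝ),
      deriv (deriv (φ a)) s = (F0 a s + ∑ i : Fin 3, F a i s * lam i) * φ a s) :
    ∀ p ∈ Ω,
      pdt (fun q => φ₀ q.1 * ∏ a : Fin 3, φ a (ω a q)) p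
      + (∑ a : Fin 3, pdx a (pdx a (fun q => φ₀ q.1 * ∏ b : Fin 3, φ b (ω b q))) p)
      + (∑ a : Fin 3, pdx a (fun q => B q.2 a * (φ₀ q.1 * ∏ b : Fin 3, φ b (ω b q))) p)
      = 0 := by
  intro p hp
  have hd : ∀ i, ∀ q ∈ Ω, DifferentiableAt ℝ (ω i) q := fun i q hq =>
    ((hω i).contDiffAt (hΩ.mem_nhds hq)).differentiableAt (by norm_num)
  -- composed derivatives
  have hcx : ∀ (ψ : ℝ → ℝ), Differentiable ℝ ψ → ∀ i a, ∀ q ∈ Ω,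
      HasDerivAt (fun s => ψ (ω i (q.1, Function.update q.2 a s)))
        (deriv ψ (ω i q) * pdx a (ω i) q) (q.2 a) := by
    intro ψ hψ i a q hq
    have h := hasDeriv_pdx a (ω i) q (hd i q hq)
    have h' : HasDerivAt ψ (deriv ψ (ω i q)) (ω i (q.1, Function.update q.2 a (q.2 a))) := by
      rw [line_self]; exact (hψ _).hasDerivAt
    exact h'.comp (q.2 a) h
  have hct : ∀ i, HasDerivAt (fun s => φ i (ω i (s, p.2)))
        (deriv (φ i) (ω i p) * pdt (ω i) p) p.1 := by
    intro i
    have h := hasDeriv_pdt (ω i) p (hd i p hp)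
    have h' : HasDerivAt (φ i) (deriv (φ i) (ω i p)) (ω i (p.1, p.2)) := (hφ i _).hasDerivAt
    exact h'.comp p.1 h
  have hux : ∀ a, ∀ q ∈ Ω, HasDerivAt
      (fun s => φ₀ q.1 * (φ 0 (ω 0 (q.1, Function.update q.2 a s))
        * φ 1 (ω 1 (q.1, Function.update q.2 a s)) * φ 2 (ω 2 (q.1, Function.update q.2 a s))))
      (φ₀ q.1 * (((deriv (φ 0) (ω 0 q) * pdx a (ω 0) q) * φ 1 (ω 1 q)
        + φ 0 (ω 0 q) * (deriv (φ 1) (ω 1 q) * pdx a (ω 1) q)) * φ 2 (ω 2 q)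
        + φ 0 (ω 0 q) * φ 1 (ω 1 q) * (deriv (φ 2) (ω 2 q) * pdx a (ω 2) q))) (q.2 a) := by
    intro a q hq
    have h := (((hcx _ (hφ 0) 0 a q hq).mul (hcx _ (hφ 1) 1 a q hq)).mul
      (hcx _ (hφ 2) 2 a q hq)).const_mul (φ₀ q.1)
    simp only [Pi.mul_apply, line_self] at h
    exact h
  simp only [Fin.prod_univ_three]
  have e1 : pdt (fun q => φ₀ q.1 * (φ 0 (ω 0 q) * φ 1 (ω 1 q) * φ 2 (ω 2 q))) p
      = deriv φ₀ p.1 * (φ 0 (ω 0 p) * φ 1 (ω 1 p) * φ 2 (ω 2 p))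
      + φ₀ p.1 * (((deriv (φ 0) (ω 0 p) * pdt (ω 0) p) * φ 1 (ω 1 p)
        + φ 0 (ω 0 p) * (deriv (φ 1) (ω 1 p) * pdt (ω 1) p)) * φ 2 (ω 2 p)
        + φ 0 (ω 0 p) * φ 1 (ω 1 p) * (deriv (φ 2) (ω 2 p) * pdt (ω 2) p)) :=
    ((hφ₀ p.1).hasDerivAt.mul (((hct 0).mul (hct 1)).mul (hct 2))).deriv
  have e2 : ∀ a, pdx a (pdx a (fun q => φ₀ q.1 * (φ 0 (ω 0 q) * φ 1 (ω 1 q) * φ 2 (ω 2 q)))) p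
      = φ₀ p.1 * (
        (deriv (deriv (φ 0)) (ω 0 p) * pdx a (ω 0) p * pdx a (ω 0) p
          + deriv (φ 0) (ω 0 p) * pdx a (pdx a (ω 0)) p) * φ 1 (ω 1 p) * φ 2 (ω 2 p)
        + (deriv (deriv (φ 1)) (ω 1 p) * pdx a (ω 1) p * pdx a (ω 1) p
          + deriv (φ 1) (ω 1 p) * pdx a (pdx a (ω 1)) p) * φ 0 (ω 0 p) * φ 2 (ω 2 p)
        + (deriv (deriv (φ 2)) (ω 2 p) * pdx a (ω 2) p * pdx a (ω 2) p
          + deriv (φ 2) (ω 2 p) * pdx a (pdx a (ω 2)) p) * φ 0 (ω 0 p) * φ 1 (ω 1 p)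
        + 2 * (deriv (φ 0) (ω 0 p) * deriv (φ 1) (ω 1 p) * φ 2 (ω 2 p)
            * (pdx a (ω 0) p * pdx a (ω 1) p)
          + deriv (φ 0) (ω 0 p) * deriv (φ 2) (ω 2 p) * φ 1 (ω 1 p)
            * (pdx a (ω 0) p * pdx a (ω 2) p)
          + deriv (φ 1) (ω 1 p) * deriv (φ 2) (ω 2 p) * φ 0 (ω 0 p)
            * (pdx a (ω 1) p * pdx a (ω 2) p))) := by
    intro a
    rw [pdx_congr a _ (fun q => φ₀ q.1 * (((deriv (φ 0) (ω 0 q) * pdx a (ω 0) q) * φ 1 (ω 1 q)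
        + φ 0 (ω 0 q) * (deriv (φ 1) (ω 1 q) * pdx a (ω 1) q)) * φ 2 (ω 2 q)
        + φ 0 (ω 0 q) * φ 1 (ω 1 q) * (deriv (φ 2) (ω 2 q) * pdx a (ω 2) q))) p
        (by filter_upwards [hΩ.mem_nhds hp] with q hq using (hux a q hq).deriv)]
    have g : ∀ i, HasDerivAt (fun s => φ i (ω i (p.1, Function.update p.2 a s)))
        (deriv (φ i) (ω i p) * pdx a (ω i) p) (p.2 a) := fun i => hcx _ (hφ i) i a p hp
    have k : ∀ i, HasDerivAt (fun s => deriv (φ i) (ω i (p.1, Function.update p.2 a s))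
          * pdx a (ω i) (p.1, Function.update p.2 a s))
        (deriv (deriv (φ i)) (ω i p) * pdx a (ω i) p * pdx a (ω i) p
          + deriv (φ i) (ω i p) * pdx a (pdx a (ω i)) p) (p.2 a) := by
      intro i
      have h := (hcx _ (hφ' i) i a p hp).mul
        (hasDeriv_pdx a (pdx a (ω i)) p (diff_pdx a (ω i) Ω hΩ (hω i) p hp))
      simp only [line_self] at h
      exact h
    have h := ((((((k 0).mul (g 1)).add ((g 0).mul (k 1))).mul (g 2)).add
      (((g 0).mul (g 1)).mul (k 2))).const_mul (φ₀ p.1))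
    refine Eq.trans h.deriv ?_
    simp only [Pi.mul_apply, Pi.add_apply, line_self]
    ring
  have e3 : ∀ a, pdx a (fun q => B q.2 a * (φ₀ q.1 * (φ 0 (ω 0 q) * φ 1 (ω 1 q) * φ 2 (ω 2 q)))) p
      = pds a (fun y => B y a) p.2 * (φ₀ p.1 * (φ 0 (ω 0 p) * φ 1 (ω 1 p) * φ 2 (ω 2 p)))
      + B p.2 a * (φ₀ p.1 * (((deriv (φ 0) (ω 0 p) * pdx a (ω 0) p) * φ 1 (ω 1 p)
        + φ 0 (ω 0 p) * (deriv (φ 1) (ω 1 p) * pdx a (ω 1) p)) * φ 2 (ω 2 p)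
        + φ 0 (ω 0 p) * φ 1 (ω 1 p) * (deriv (φ 2) (ω 2 p) * pdx a (ω 2) p))) := by
    intro a
    have hb : HasDerivAt (fun s => B (Function.update p.2 a s) a)
        (pds a (fun y => B y a) p.2) (p.2 a) := by
      have hB' : Differentiable ℝ (fun q : ℝ × (Fin 3 → ℝ) => B q.2 a) := by
        have := hB.differentiable (by norm_num)
        fun_prop
      exact hasDeriv_pdx a (fun q => B q.2 a) p (hB' p)
    refine Eq.trans (hb.mul (hux a p hp)).deriv ?_
    simp only [line_self, Function.update_eq_self]
  simp only [e1, e2, e3, hφ₀', hφ'']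
  have a1 := h1 p hp 0 1 (by decide)
  have a2 := h1 p hp 0 2 (by decide)
  have a3 := h1 p hp 1 2 (by decide)
  have b0 := h2 p hp 0
  have b1 := h2 p hp 1
  have b2 := h2 p hp 2
  have c0 := h3 p hp 0
  have c1 := h3 p hp 1
  have c2 := h3 p hp 2
  have d := h4 p hp
  simp only [Fin.sum_univ_three] at a1 a2 a3 b0 b1 b2 c0 c1 c2 d ⊢
  linear_combination (φ₀ p.1 * (φ 0 (ω 0 p) * φ 1 (ω 1 p) * φ 2 (ω 2 p)))
      * (d + lam 0 * b0 + lam 1 * b1 + lam 2 * b2)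
    + φ₀ p.1 * deriv (φ 0) (ω 0 p) * φ 1 (ω 1 p) * φ 2 (ω 2 p) * c0
    + φ₀ p.1 * deriv (φ 1) (ω 1 p) * φ 0 (ω 0 p) * φ 2 (ω 2 p) * c1
    + φ₀ p.1 * deriv (φ 2) (ω 2 p) * φ 0 (ω 0 p) * φ 1 (ω 1 p) * c2
    + 2 * φ₀ p.1 * deriv (φ 0) (ω 0 p) * deriv (φ 1) (ω 1 p) * φ 2 (ω 2 p) * a1
    + 2 * φ₀ p.1 * deriv (φ 0) (ω 0 p) * deriv (φ 2) (ω 2 p) * φ 1 (ω 1 p) * a2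
    + 2 * φ₀ p.1 * deriv (φ 1) (ω 1 p) * deriv (φ 2) (ω 2 p) * φ 0 (ω 0 p) * a3
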